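/- arXiv:2203.02067 — 5 statements merged into one kernel-verified Lean document; each statement's English description precedes it below -/
import Mathlib

section
/- Let n be a positive natural number, let Φ : ℝⁿ → ℝ be continuous, let V : ℝⁿ → ℝ be continuously differentiable, let f : ℝⁿ → ℝⁿ, and let x : ℝ → ℝⁿ be differentiable with x'(t) = f(x(t)) for all t ≥ 0 and with {x(t) : t ≥ 0} bounded. Let U ∈ ℝ and suppose Φ(y) + DV(y)[f(y)] ≤ U for all y ∈ ℝⁿ. If the long-time average L = lim_{τ→∞} (1/τ)∫₀^τ Φ(x(t)) dt exists, then L ≤ U. -/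
open Filter

/-- Auxiliary function method: if `Φ(y) + DV(y)[f(y)] ≤ U` for all `y`, then along any bounded
trajectory of `ẋ = f(x)` the long-time average of `Φ`, if it exists, is at most `U`. -/
theorem auxiliary_function_upper_bound
    (n : ℕ) (hn : 0 < n)
    (Φ : EuclideanSpace ℝ (Fin n) → ℝ) (hΦ : Continuous Φ)
    (V : EuclideanSpace ℝ (Fin n) → ℝ) (hV : ContDiff ℝ 1 V)
    (f : EuclideanSpace ℝ (Fin n) → EuclideanSpace ℝ (Fin n))
    (x : ℝ → EuclideanSpace ℝ (Fin n))
    (hx : ∀ t : ℝ, 0 ≤ t → HasDerivAt x (f (x t)) t)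
    (hbdd : Bornology.IsBounded (x '' Set.Ici (0:ℝ)))
    (U : ℝ) (hU : ∀ y, Φ y + fderiv ℝ V y (f y) ≤ U)
    (L : ℝ)
    (hL : Tendsto (fun τ : ℝ => (1 / τ) * ∫ t in (0:ℝ)..τ, Φ (x t)) atTop (nhds L)) :
    L ≤ U := by
  have hcx : ContinuousOn x (Set.Ici 0) := fun t ht => (hx t ht).continuousAt.continuousWithinAt
  obtain ⟨C, hC⟩ := (hbdd.isCompact_closure).exists_bound_of_continuousOn
    (f := V) hV.continuous.continuousOn
  have hCx : ∀ t : ℝ, 0 ≤ t → |V (x t)| ≤ C := fun t ht =>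
    hC _ (subset_closure ⟨t, ht, rfl⟩)
  have key : ∀ τ : ℝ, 0 < τ → (1 / τ) * ∫ t in (0:ℝ)..τ, Φ (x t) ≤ U + 2 * C * τ⁻¹ := by
    intro τ hτ
    have hcΦ : ContinuousOn (fun t => Φ (x t)) (Set.Icc 0 τ) :=
      hΦ.comp_continuousOn (hcx.mono Set.Icc_subset_Ici_self)
    have hd : ∀ t : ℝ, 0 ≤ t →
        HasDerivAt (fun t => V (x t)) (fderiv ℝ V (x t) (f (x t))) t := fun t ht =>
      ((hV.differentiable one_ne_zero (x t)).hasFDerivAt).comp_hasDerivAt t (hx t ht)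
    have h1 := intervalIntegral.sub_le_integral_of_hasDeriv_right_of_le
      (g := fun t => V (x t)) (φ := fun t => U - Φ (x t)) hτ.le
      (fun t ht => (hd t ht.1).continuousAt.continuousWithinAt)
      (fun t ht => (hd t ht.1.le).hasDerivWithinAt)
      ((continuousOn_const.sub hcΦ).integrableOn_Icc)
      (fun t _ => by linarith [hU (x t)])
    rw [intervalIntegral.integral_sub (by simp)
      (hcΦ.intervalIntegrable_of_Icc hτ.le)] at h1
    simp only [intervalIntegral.integral_const, sub_zero, smul_eq_mul] at h1
    have h2 := abs_le.1 (hCx τ hτ.le)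
    have h3 := abs_le.1 (hCx 0 le_rfl)
    have h4 : ∫ t in (0:ℝ)..τ, Φ (x t) ≤ τ * U + 2 * C := by linarith [h2.1, h3.2]
    have h5 := mul_le_mul_of_nonneg_left h4 (one_div_pos.2 hτ).le
    have h6 : (1 / τ) * (τ * U + 2 * C) = U + 2 * C * τ⁻¹ := by
      field_simp
    linarith
  have hlim : Tendsto (fun τ : ℝ => U + 2 * C * τ⁻¹) atTop (nhds U) := by
    simpa using (tendsto_inv_atTop_zero.const_mul (2 * C)).const_add U
  exact le_of_tendsto_of_tendsto hL hlim
    ((eventually_gt_atTop 0).mono fun τ hτ => key τ hτ)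
end

section
/- Let n be a positive natural number, let Φ and V be real multivariate polynomials in n variables, let f₁,…,fₙ be real multivariate polynomials in n variables, and let U ∈ ℝ. Suppose there are finitely many real multivariate polynomials σ₁,…,σ_J in n variables such that, in the polynomial ring, U − Φ − Σᵢ fᵢ·(∂V/∂xᵢ) = Σⱼ σⱼ². Then for every differentiable curve x : ℝ → ℝⁿ satisfying x'(t)ᵢ = fᵢ(x(t)) for all t ≥ 0 and i = 1,…,n, with {x(t) : t ≥ 0} bounded, and for which the long-time average L = lim_{τ→∞} (1/τ)∫₀^τ Φ(x(t)) dt exists, one has L ≤ U. -/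
open Filter MvPolynomial

theorem hasDerivAt_eval_curve {n : ℕ} (p : MvPolynomial (Fin n) ℝ) (x : ℝ → Fin n → ℝ)
    (vel : Fin n → ℝ) (t : ℝ) (hx : ∀ i, HasDerivAt (fun s => x s i) (vel i) t) :
    HasDerivAt (fun s => eval (x s) p) (∑ i, vel i * eval (x t) (pderiv i p)) t := by
  induction p using MvPolynomial.induction_on with
  | C a => simpa using hasDerivAt_const t a
  | add p q hp hq =>
    simp only [map_add, mul_add, Finset.sum_add_distrib]
    exact hp.add hq
  | mul_X p j hp =>
    have h := hp.mul (hx j)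
    simp only [map_mul, eval_X]
    refine h.congr_deriv ?_
    simp only [Derivation.leibniz, pderiv_X, smul_eq_mul, map_add, map_mul, eval_X, mul_add,
      Finset.sum_add_distrib]
    have h1 : ∑ i, vel i * (eval (x t) p * eval (x t) (Pi.single (M := fun _ => MvPolynomial (Fin n) ℝ) i 1 j))
        = eval (x t) p * vel j := by
      rw [Finset.sum_eq_single j]
      · simp [mul_comm]
      · intro b _ hb
        simp [hb.symm]
      · simp
    rw [h1, add_comm, Finset.sum_mul]
    congr 1
    exact Finset.sum_congr rfl fun i _ => by ring

/-- Soundness of the sum-of-squares certificate: if `U − Φ − Σᵢ fᵢ·(∂V/∂xᵢ)` is a sum of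
squares of polynomials, then `U` bounds the long-time average of `Φ` along every bounded
trajectory of the polynomial ODE `ẋ = f(x)` for which that average exists. -/
theorem sos_certificate_upper_bound
    (n : ℕ) (hn : 0 < n)
    (Φ V : MvPolynomial (Fin n) ℝ)
    (f : Fin n → MvPolynomial (Fin n) ℝ)
    (U : ℝ) (J : ℕ) (σs : Fin J → MvPolynomial (Fin n) ℝ)
    (hSOS : C U - Φ - ∑ i : Fin n, f i * pderiv i V = ∑ j : Fin J, (σs j) ^ 2)
    (x : ℝ → Fin n → ℝ)
    (hx : ∀ t : ℝ, 0 ≤ t → ∀ i : Fin n,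
      HasDerivAt (fun s => x s i) (eval (x t) (f i)) t)
    (hbdd : Bornology.IsBounded (x '' Set.Ici (0:ℝ)))
    (L : ℝ)
    (hL : Tendsto (fun τ : ℝ => (1 / τ) * ∫ t in (0:ℝ)..τ, eval (x t) Φ) atTop (nhds L)) :
    L ≤ U := by
  have hd : ∀ t : ℝ, 0 ≤ t → HasDerivAt (fun s => eval (x s) V)
      (∑ i, eval (x t) (f i) * eval (x t) (pderiv i V)) t :=
    fun t ht => hasDerivAt_eval_curve V x _ t (hx t ht)
  have hxc : ContinuousOn x (Set.Ici 0) := fun t ht =>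
    (continuousAt_pi.2 fun i => (hx t ht i).continuousAt).continuousWithinAt
  have hpc : ∀ p : MvPolynomial (Fin n) ℝ, ContinuousOn (fun t => eval (x t) p) (Set.Ici 0) :=
    fun p => (MvPolynomial.continuous_eval p).comp_continuousOn hxc
  have hpt : ∀ t : ℝ, eval (x t) Φ ≤
      U - ∑ i, eval (x t) (f i) * eval (x t) (pderiv i V) := by
    intro t
    have h := congrArg (eval (x t)) hSOS
    simp only [map_sub, map_sum, map_mul, map_pow, eval_C] at h
    have h2 : 0 ≤ ∑ j, (eval (x t) (σs j)) ^ 2 := Finset.sum_nonneg fun j _ => sq_nonneg _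
    linarith
  obtain ⟨B, hB⟩ : ∃ B, ∀ y ∈ closure (x '' Set.Ici (0:ℝ)), ‖eval y V‖ ≤ B :=
    hbdd.isCompact_closure.exists_bound_of_continuousOn
      (MvPolynomial.continuous_eval V).continuousOn
  have hBt : ∀ t : ℝ, 0 ≤ t → |eval (x t) V| ≤ B := fun t ht =>
    hB _ (subset_closure ⟨t, ht, rfl⟩)
  have hint : ∀ τ : ℝ, 0 < τ → (1 / τ) * ∫ t in (0:ℝ)..τ, eval (x t) Φ ≤ U + (2 * B) / τ := by
    intro τ hτ
    have hsub : Set.uIcc 0 τ ⊆ Set.Ici (0:ℝ) := by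
      rw [Set.uIcc_of_le hτ.le]; exact Set.Icc_subset_Ici_self
    have i1 : IntervalIntegrable (fun t => eval (x t) Φ) MeasureTheory.volume 0 τ :=
      ((hpc Φ).mono hsub).intervalIntegrable
    have i2 : IntervalIntegrable (fun t => ∑ i, eval (x t) (f i) * eval (x t) (pderiv i V))
        MeasureTheory.volume 0 τ :=
      (continuousOn_finsetSum _ fun i _ =>
        ((hpc (f i)).mul (hpc (pderiv i V))).mono hsub).intervalIntegrable
    have h1 := intervalIntegral.integral_mono_on hτ.le i1
      ((intervalIntegrable_const (c := U)).sub i2) (fun t _ => hpt t)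
    have h3 := intervalIntegral.integral_eq_sub_of_hasDerivAt
      (fun t ht => hd t (hsub ht)) i2
    rw [intervalIntegral.integral_sub intervalIntegrable_const i2, h3,
      intervalIntegral.integral_const, smul_eq_mul] at h1
    have b1 := abs_le.1 (hBt τ hτ.le)
    have b0 := abs_le.1 (hBt 0 le_rfl)
    rw [one_div, inv_mul_le_iff₀ hτ, mul_add, mul_div_cancel₀ _ hτ.ne']
    linarith
  have hlim : Tendsto (fun τ : ℝ => U + (2 * B) / τ) atTop (nhds U) := by
    simpa using (tendsto_const_nhds (x := U)).add
      (tendsto_const_nhds (x := 2 * B) |>.div_atTop tendsto_id)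
  exact le_of_tendsto_of_tendsto hL hlim ((eventually_gt_atTop 0).mono hint)
end

section
/- Let n be a positive natural number, let Λ : ℝⁿ → ℝⁿ be a linear map with Λ∘Λ = id, let Φ : ℝⁿ → ℝ satisfy Φ(Λy) = Φ(y) for all y, let f : ℝⁿ → ℝⁿ satisfy f(Λy) = Λ·f(y) for all y, and let V : ℝⁿ → ℝ be continuously differentiable. Suppose U ∈ ℝ satisfies Φ(y) + DV(y)[f(y)] ≤ U for all y ∈ ℝⁿ. Define Ṽ(y) = ½(V(y) + V(Λy)). Then Ṽ is continuously differentiable, Ṽ(Λy) = Ṽ(y) for all y, and Φ(y) + DṼ(y)[f(y)] ≤ U for all y ∈ ℝⁿ. -/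
/-- If `Φ` and the vector field `f` are invariant under a linear involution `Λ`, then the
symmetrization `Ṽ(y) = ½(V(y) + V(Λy))` of any auxiliary function `V` certifying the bound
`U` is continuously differentiable, `Λ`-symmetric, and certifies the same bound. -/
theorem symmetrized_auxiliary_function
    (n : ℕ) (hn : 0 < n)
    (Λ : EuclideanSpace ℝ (Fin n) →ₗ[ℝ] EuclideanSpace ℝ (Fin n))
    (hΛ : ∀ y, Λ (Λ y) = y)
    (Φ : EuclideanSpace ℝ (Fin n) → ℝ) (hΦ : ∀ y, Φ (Λ y) = Φ y)
    (f : EuclideanSpace ℝ (Fin n) → EuclideanSpace ℝ (Fin n))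
    (hf : ∀ y, f (Λ y) = Λ (f y))
    (V : EuclideanSpace ℝ (Fin n) → ℝ) (hV : ContDiff ℝ 1 V)
    (U : ℝ) (hU : ∀ y, Φ y + fderiv ℝ V y (f y) ≤ U)
    (W : EuclideanSpace ℝ (Fin n) → ℝ)
    (hW : ∀ y, W y = (1/2) * (V y + V (Λ y))) :
    ContDiff ℝ 1 W ∧ (∀ y, W (Λ y) = W y) ∧ (∀ y, Φ y + fderiv ℝ W y (f y) ≤ U) := by
  have hL : ∀ y, Λ.toContinuousLinearMap y = Λ y := fun y => rfl
  have hWf : W = fun y => (1/2) * (V y + V (Λ.toContinuousLinearMap y)) := funext hW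
  refine ⟨?_, ?_, ?_⟩
  · rw [hWf]
    exact contDiff_const.mul (hV.add (hV.comp Λ.toContinuousLinearMap.contDiff))
  · intro y
    rw [hW, hW, hΛ, add_comm]
  · intro y
    have hd : Differentiable ℝ V := hV.differentiable (by norm_num)
    have h1 := (hd y).hasFDerivAt
    have h2 := (hd (Λ.toContinuousLinearMap y)).hasFDerivAt.comp y
      Λ.toContinuousLinearMap.hasFDerivAt
    have h3 := (h1.add h2).const_mul (1/2 : ℝ)
    have h4 : fderiv ℝ W y = _ := (h3.congr_of_eventuallyEq
      (Filter.Eventually.of_forall hW)).fderiv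
    have e : fderiv ℝ W y (f y)
        = (1/2) * (fderiv ℝ V y (f y) + fderiv ℝ V (Λ y) (Λ (f y))) := by
      rw [h4]
      rfl
    have a := hU y
    have b := hU (Λ y)
    rw [hΦ, hf] at b
    rw [e]
    linarith
end

section
/- Let σ, ℛ, k > 0, set ρ₁ = k² + 1 and ρ₂ = k² + 4, and let (ψ₁₁, ψ₀₁, ψ₁₂, θ₁₁, θ₀₂, θ₁₂, ψ₀₃, θ₀₄) : ℝ → ℝ⁸ be a differentiable solution of the HK8 system: ψ₁₁' = −σρ₁ψ₁₁ + σℛ(k/ρ₁)θ₁₁ + (k/2)((k²+3)/ρ₁)ψ₀₁ψ₁₂ − (3k/2)((k²−5)/ρ₁)ψ₁₂ψ₀₃; ψ₀₁' = −σψ₀₁ − (3k/4)ψ₁₁ψ₁₂; ψ₁₂' = −σρ₂ψ₁₂ − σℛ(k/ρ₂)θ₁₂ − (k³/(2ρ₂))ψ₁₁ψ₀₁ + (3k/2)((k²−8)/ρ₂)ψ₁₁ψ₀₃; θ₁₁' = −ρ₁θ₁₁ + kψ₁₁ − kψ₁₁θ₀₂ − (k/2)ψ₀₁θ₁₂ +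 (3k/2)θ₁₂ψ₀₃; θ₀₂' = −4θ₀₂ + (k/2)ψ₁₁θ₁₁; θ₁₂' = −ρ₂θ₁₂ − kψ₁₂ + (k/2)ψ₀₁θ₁₁ − (3k/2)ψ₀₃θ₁₁ + 2kψ₁₂θ₀₄; ψ₀₃' = −9σψ₀₃ + (k/4)ψ₁₁ψ₁₂; θ₀₄' = −16θ₀₄ − kψ₁₂θ₁₂. Define the truncated kinetic energy K(t) = (1/8)ρ₁ψ₁₁² + (1/8)ρ₂ψ₁₂² + (1/4)ψ₀₁² + (9/4)ψ₀₃². Then along the solution, K'(t) = −σ( (1/4)ρ₁²ψ₁₁² + (1/4)ρ₂²ψ₁₂² + (1/2)ψ₀₁² + (81/2)ψ₀₃² ) + (1/4)σℛk( ψ₁₁θ₁₁ − ψ₁₂θ₁₂ ). In particular, the quadratic (nonlinear) terms of the stream-function equations make no net contribution to the kinetic energy balance. -/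
/-- Truncated kinetic energy balance for the HK8 model: along any solution, the derivative
of the truncated kinetic energy `K` equals the dissipation plus buoyancy-flux terms, with
no net contribution from the quadratic (nonlinear) terms. -/
theorem HK8_kinetic_energy_balance
    (σ ℛ k : ℝ) (hσ : 0 < σ) (hℛ : 0 < ℛ) (hk : 0 < k)
    (ρ₁ ρ₂ : ℝ) (hρ₁ : ρ₁ = k ^ 2 + 1) (hρ₂ : ρ₂ = k ^ 2 + 4)
    (ψ₁₁ ψ₀₁ ψ₁₂ θ₁₁ θ₀₂ θ₁₂ ψ₀₃ θ₀₄ : ℝ → ℝ)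
    (hψ₁₁ : ∀ t : ℝ, HasDerivAt ψ₁₁
      (-σ * ρ₁ * ψ₁₁ t + σ * ℛ * (k / ρ₁) * θ₁₁ t
        + (k / 2) * ((k ^ 2 + 3) / ρ₁) * ψ₀₁ t * ψ₁₂ t
        - (3 * k / 2) * ((k ^ 2 - 5) / ρ₁) * ψ₁₂ t * ψ₀₃ t) t)
    (hψ₀₁ : ∀ t : ℝ, HasDerivAt ψ₀₁ (-σ * ψ₀₁ t - (3 * k / 4) * ψ₁₁ t * ψ₁₂ t) t)
    (hψ₁₂ : ∀ t : ℝ, HasDerivAt ψ₁₂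
      (-σ * ρ₂ * ψ₁₂ t - σ * ℛ * (k / ρ₂) * θ₁₂ t
        - (k ^ 3 / (2 * ρ₂)) * ψ₁₁ t * ψ₀₁ t
        + (3 * k / 2) * ((k ^ 2 - 8) / ρ₂) * ψ₁₁ t * ψ₀₃ t) t)
    (hθ₁₁ : ∀ t : ℝ, HasDerivAt θ₁₁
      (-ρ₁ * θ₁₁ t + k * ψ₁₁ t - k * ψ₁₁ t * θ₀₂ t
        - (k / 2) * ψ₀₁ t * θ₁₂ t + (3 * k / 2) * θ₁₂ t * ψ₀₃ t) t)
    (hθ₀₂ : ∀ t : ℝ, HasDerivAt θ₀₂ (-4 * θ₀₂ t + (k / 2) * ψ₁₁ t * θ₁₁ t) t)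
    (hθ₁₂ : ∀ t : ℝ, HasDerivAt θ₁₂
      (-ρ₂ * θ₁₂ t - k * ψ₁₂ t + (k / 2) * ψ₀₁ t * θ₁₁ t
        - (3 * k / 2) * ψ₀₃ t * θ₁₁ t + 2 * k * ψ₁₂ t * θ₀₄ t) t)
    (hψ₀₃ : ∀ t : ℝ, HasDerivAt ψ₀₃ (-9 * σ * ψ₀₃ t + (k / 4) * ψ₁₁ t * ψ₁₂ t) t)
    (hθ₀₄ : ∀ t : ℝ, HasDerivAt θ₀₄ (-16 * θ₀₄ t - k * ψ₁₂ t * θ₁₂ t) t)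
    (K : ℝ → ℝ)
    (hK : ∀ t : ℝ, K t = (1/8) * ρ₁ * (ψ₁₁ t) ^ 2 + (1/8) * ρ₂ * (ψ₁₂ t) ^ 2
      + (1/4) * (ψ₀₁ t) ^ 2 + (9/4) * (ψ₀₃ t) ^ 2) :
    ∀ t : ℝ, HasDerivAt K
      (-σ * ((1/4) * ρ₁ ^ 2 * (ψ₁₁ t) ^ 2 + (1/4) * ρ₂ ^ 2 * (ψ₁₂ t) ^ 2
          + (1/2) * (ψ₀₁ t) ^ 2 + (81/2) * (ψ₀₃ t) ^ 2)
        + (1/4) * σ * ℛ * k * (ψ₁₁ t * θ₁₁ t - ψ₁₂ t * θ₁₂ t)) t := by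
  intro t
  have h1 : ρ₁ ≠ 0 := by rw [hρ₁]; positivity
  have h2 : ρ₂ ≠ 0 := by rw [hρ₂]; positivity
  have hKf : K = fun t => (1/8) * ρ₁ * (ψ₁₁ t) ^ 2 + (1/8) * ρ₂ * (ψ₁₂ t) ^ 2
      + (1/4) * (ψ₀₁ t) ^ 2 + (9/4) * (ψ₀₃ t) ^ 2 := funext hK
  rw [hKf]
  have hd := (((((hψ₁₁ t).fun_pow 2).const_mul ((1/8) * ρ₁)).fun_add
    (((hψ₁₂ t).fun_pow 2).const_mul ((1/8) * ρ₂))).fun_add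
    (((hψ₀₁ t).fun_pow 2).const_mul (1/4))).fun_add
    (((hψ₀₃ t).fun_pow 2).const_mul (9/4))
  refine hd.congr_deriv ?_
  clear hd hKf
  push_cast
  field_simp
  ring
end

section
/- Let σ, ℛ, k > 0 and let (ψ₁₁, ψ₀₁, ψ₁₂, θ₁₁, θ₀₂, θ₁₂, ψ₀₃, θ₀₄) : ℝ → ℝ⁸ be a differentiable solution of the HK8 system (with ρ₁ = k²+1, ρ₂ = k²+4): ψ₁₁' = −σρ₁ψ₁₁ + σℛ(k/ρ₁)θ₁₁ + (k/2)((k²+3)/ρ₁)ψ₀₁ψ₁₂ − (3k/2)((k²−5)/ρ₁)ψ₁₂ψ₀₃; ψ₀₁' = −σψ₀₁ − (3k/4)ψ₁₁ψ₁₂; ψ₁₂' = −σρ₂ψ₁₂ − σℛ(k/ρ₂)θ₁₂ − (k³/(2ρ₂))ψ₁₁ψ₀₁ + (3k/2)((k²−8)/ρ₂)ψ₁₁ψ₀₃; θ₁₁' = −ρ₁θ₁₁ + kψ₁₁ − kψ₁₁θ₀₂ − (k/2)ψ₀₁θ₁₂ + (3k/2)θ₁₂ψ₀₃; θ₀₂'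 = −4θ₀₂ + (k/2)ψ₁₁θ₁₁; θ₁₂' = −ρ₂θ₁₂ − kψ₁₂ + (k/2)ψ₀₁θ₁₁ − (3k/2)ψ₀₃θ₁₁ + 2kψ₁₂θ₀₄; ψ₀₃' = −9σψ₀₃ + (k/4)ψ₁₁ψ₁₂; θ₀₄' = −16θ₀₄ − kψ₁₂θ₁₂. Suppose the solution is bounded on [0,∞) and that the long-time averages a₁ = lim_{τ→∞}(1/τ)∫₀^τ ψ₁₁θ₁₁ dt, a₂ = lim_{τ→∞}(1/τ)∫₀^τ ψ₁₂θ₁₂ dt, b₁ = lim_{τ→∞}(1/τ)∫₀^τ θ₀₂ dt, and b₂ = lim_{τ→∞}(1/τ)∫₀^τ θ₀₄ dt all exist. Then 1 + (k/4)(a₁ − a₂) = 1 + 2b₁ + 4b₂; that is, the two truncated Nusselt number expressions coincide. -/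
open Filter

/-- If `f' = c f + d g` with `f` bounded on `[0, ∞)`, the long-time averages balance. -/
theorem average_balance (f g : ℝ → ℝ) (c d M a b : ℝ) (hg : Continuous g)
    (hf : ∀ t : ℝ, HasDerivAt f (c * f t + d * g t) t)
    (hM : ∀ t : ℝ, 0 ≤ t → |f t| ≤ M)
    (ha : Tendsto (fun τ : ℝ => (1 / τ) * ∫ t in (0:ℝ)..τ, g t) atTop (nhds a))
    (hb : Tendsto (fun τ : ℝ => (1 / τ) * ∫ t in (0:ℝ)..τ, f t) atTop (nhds b)) :
    c * b + d * a = 0 := by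
  have hfc : Continuous f := continuous_iff_continuousAt.2 fun t => (hf t).continuousAt
  have h1 := (hb.const_mul c).add (ha.const_mul d)
  have key : ∀ τ : ℝ, c * ((1 / τ) * ∫ t in (0:ℝ)..τ, f t) + d * ((1 / τ) * ∫ t in (0:ℝ)..τ, g t)
      = (1 / τ) * (f τ - f 0) := by
    intro τ
    have hcont : Continuous fun t => c * f t + d * g t := by fun_prop
    rw [← intervalIntegral.integral_eq_sub_of_hasDerivAt (fun t _ => hf t)
      (hcont.intervalIntegrable 0 τ),
      intervalIntegral.integral_add ((hfc.const_mul c).intervalIntegrable 0 τ)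
      ((hg.const_mul d).intervalIntegrable 0 τ), intervalIntegral.integral_const_mul,
      intervalIntegral.integral_const_mul]
    ring
  simp only [key] at h1
  have h2 : Tendsto (fun τ : ℝ => (1 / τ) * (f τ - f 0)) atTop (nhds 0) := by
    have h3 : Tendsto (fun τ : ℝ => (2 * M) * τ⁻¹) atTop (nhds 0) := by
      simpa using tendsto_inv_atTop_zero.const_mul (2 * M)
    refine squeeze_zero_norm' ?_ h3
    filter_upwards [eventually_gt_atTop (0:ℝ)] with τ hτ
    have hpos : 0 < τ⁻¹ := inv_pos.2 hτ
    rw [Real.norm_eq_abs, abs_mul, one_div, abs_of_pos hpos, mul_comm]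
    have h4 := abs_sub (f τ) (f 0)
    have h5 := hM τ hτ.le
    have h6 := hM 0 le_rfl
    exact mul_le_mul_of_nonneg_right (by linarith) hpos.le
  exact tendsto_nhds_unique h1 h2

/-- For any bounded solution of the HK8 model along which the relevant long-time averages
exist, the two truncated Nusselt number expressions coincide:
`1 + (k/4)(⟨ψ₁₁θ₁₁⟩ − ⟨ψ₁₂θ₁₂⟩) = 1 + 2⟨θ₀₂⟩ + 4⟨θ₀₄⟩`. -/
theorem HK8_nusselt_expressions_coincide
    (σ ℛ k : ℝ) (hσ : 0 < σ) (hℛ : 0 < ℛ) (hk : 0 < k)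
    (ρ₁ ρ₂ : ℝ) (hρ₁ : ρ₁ = k ^ 2 + 1) (hρ₂ : ρ₂ = k ^ 2 + 4)
    (ψ₁₁ ψ₀₁ ψ₁₂ θ₁₁ θ₀₂ θ₁₂ ψ₀₃ θ₀₄ : ℝ → ℝ)
    (hψ₁₁ : ∀ t : ℝ, HasDerivAt ψ₁₁
      (-σ * ρ₁ * ψ₁₁ t + σ * ℛ * (k / ρ₁) * θ₁₁ t
        + (k / 2) * ((k ^ 2 + 3) / ρ₁) * ψ₀₁ t * ψ₁₂ t
        - (3 * k / 2) * ((k ^ 2 - 5) / ρ₁) * ψ₁₂ t * ψ₀₃ t) t)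
    (hψ₀₁ : ∀ t : ℝ, HasDerivAt ψ₀₁ (-σ * ψ₀₁ t - (3 * k / 4) * ψ₁₁ t * ψ₁₂ t) t)
    (hψ₁₂ : ∀ t : ℝ, HasDerivAt ψ₁₂
      (-σ * ρ₂ * ψ₁₂ t - σ * ℛ * (k / ρ₂) * θ₁₂ t
        - (k ^ 3 / (2 * ρ₂)) * ψ₁₁ t * ψ₀₁ t
        + (3 * k / 2) * ((k ^ 2 - 8) / ρ₂) * ψ₁₁ t * ψ₀₃ t) t)
    (hθ₁₁ : ∀ t : ℝ, HasDerivAt θ₁₁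
      (-ρ₁ * θ₁₁ t + k * ψ₁₁ t - k * ψ₁₁ t * θ₀₂ t
        - (k / 2) * ψ₀₁ t * θ₁₂ t + (3 * k / 2) * θ₁₂ t * ψ₀₃ t) t)
    (hθ₀₂ : ∀ t : ℝ, HasDerivAt θ₀₂ (-4 * θ₀₂ t + (k / 2) * ψ₁₁ t * θ₁₁ t) t)
    (hθ₁₂ : ∀ t : ℝ, HasDerivAt θ₁₂
      (-ρ₂ * θ₁₂ t - k * ψ₁₂ t + (k / 2) * ψ₀₁ t * θ₁₁ t
        - (3 * k / 2) * ψ₀₃ t * θ₁₁ t + 2 * k * ψ₁₂ t * θ₀₄ t) t)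
    (hψ₀₃ : ∀ t : ℝ, HasDerivAt ψ₀₃ (-9 * σ * ψ₀₃ t + (k / 4) * ψ₁₁ t * ψ₁₂ t) t)
    (hθ₀₄ : ∀ t : ℝ, HasDerivAt θ₀₄ (-16 * θ₀₄ t - k * ψ₁₂ t * θ₁₂ t) t)
    (M : ℝ)
    (hbdd : ∀ t : ℝ, 0 ≤ t →
      |ψ₁₁ t| ≤ M ∧ |ψ₀₁ t| ≤ M ∧ |ψ₁₂ t| ≤ M ∧ |θ₁₁ t| ≤ M ∧
      |θ₀₂ t| ≤ M ∧ |θ₁₂ t| ≤ M ∧ |ψ₀₃ t| ≤ M ∧ |θ₀₄ t| ≤ M)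
    (a₁ a₂ b₁ b₂ : ℝ)
    (ha₁ : Tendsto (fun τ : ℝ => (1 / τ) * ∫ t in (0:ℝ)..τ, ψ₁₁ t * θ₁₁ t) atTop (nhds a₁))
    (ha₂ : Tendsto (fun τ : ℝ => (1 / τ) * ∫ t in (0:ℝ)..τ, ψ₁₂ t * θ₁₂ t) atTop (nhds a₂))
    (hb₁ : Tendsto (fun τ : ℝ => (1 / τ) * ∫ t in (0:ℝ)..τ, θ₀₂ t) atTop (nhds b₁))
    (hb₂ : Tendsto (fun τ : ℝ => (1 / τ) * ∫ t in (0:ℝ)..τ, θ₀₄ t) atTop (nhds b₂)) :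
    1 + (k / 4) * (a₁ - a₂) = 1 + 2 * b₁ + 4 * b₂ := by
  have c₁ : Continuous ψ₁₁ := continuous_iff_continuousAt.2 fun t => (hψ₁₁ t).continuousAt
  have c₂ : Continuous θ₁₁ := continuous_iff_continuousAt.2 fun t => (hθ₁₁ t).continuousAt
  have c₃ : Continuous ψ₁₂ := continuous_iff_continuousAt.2 fun t => (hψ₁₂ t).continuousAt
  have c₄ : Continuous θ₁₂ := continuous_iff_continuousAt.2 fun t => (hθ₁₂ t).continuousAt
  have e₁ := average_balance θ₀₂ (fun t => ψ₁₁ t * θ₁₁ t) (-4) (k / 2) M a₁ b₁ (c₁.mul c₂)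
    (fun t => (hθ₀₂ t).congr_deriv (by ring))
    (fun t ht => (hbdd t ht).2.2.2.2.1) ha₁ hb₁
  have e₂ := average_balance θ₀₄ (fun t => ψ₁₂ t * θ₁₂ t) (-16) (-k) M a₂ b₂ (c₃.mul c₄)
    (fun t => (hθ₀₄ t).congr_deriv (by ring))
    (fun t ht => (hbdd t ht).2.2.2.2.2.2.2) ha₂ hb₂
  linarith
end
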